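/- arXiv:1212.1023 — 2 statements merged into one kernel-verified Lean document; each statement's English description precedes it below -/
import Mathlib

section
/- The family of n(n+1)/2 polynomials {J_{k,i} : 1 ≤ k ≤ n, 0 ≤ i ≤ k−1}, regarded as elements of the polynomial ring K[x] in the n² matrix entries, is algebraically independent over K. -/
open Matrix MvPolynomial

/-- The polynomial invariant `J_{k,i}` evaluated at a matrix `A` over a
commutative ring: the determinant of the `k × k` matrix whose first `k - i`
rows are the last `k - i` rows of `A` restricted to the first `k` columns, and
whose last `i` rows are the last `i` rows of the adjugate matrix `A*`
restricted to the first `k` columns. -/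
def Jki {n : ℕ} {R : Type*} [CommRing R] (k i : ℕ) (hk : k ≤ n) (hik : i < k)
    (A : Matrix (Fin n) (Fin n) R) : R :=
  Matrix.det (Matrix.of fun r c : Fin k =>
    if h : (r : ℕ) < k - i then
      A ⟨n - (k - i) + (r : ℕ), by have := r.isLt; omega⟩
        ⟨(c : ℕ), by have := c.isLt; omega⟩
    else
      A.adjugate ⟨n - i + ((r : ℕ) - (k - i)), by have := r.isLt; omega⟩
        ⟨(c : ℕ), by have := c.isLt; omega⟩)

/-- The generic matrix `X = (x_{ab})` over the polynomial ring `K[x]` in the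
`n²` matrix entries. -/
noncomputable def genMatrix (K : Type*) [CommRing K] (n : ℕ) :
    Matrix (Fin n) (Fin n) (MvPolynomial (Fin n × Fin n) K) :=
  Matrix.of fun a b => MvPolynomial.X (a, b)


theorem det_corner {K : Type*} [CommRing K] (s : ℕ) (M N : Matrix (Fin (s+1)) (Fin (s+1)) K) (t : K)
    (h : ∀ p q, ¬ (p = Fin.last s ∧ q = Fin.last s) → N p q = M p q)
    (ht : N (Fin.last s) (Fin.last s) = M (Fin.last s) (Fin.last s) + t) :
    N.det = M.det + t * (M.submatrix Fin.castSucc Fin.castSucc).det := by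
  rw [Matrix.det_succ_row N (Fin.last s), Matrix.det_succ_row M (Fin.last s), Fin.sum_univ_castSucc,
    Fin.sum_univ_castSucc]
  have hs : ∀ q, N.submatrix (Fin.last s).succAbove (Fin.succAbove q) =
      M.submatrix (Fin.last s).succAbove (Fin.succAbove q) := by
    intro q
    ext a b
    simp only [submatrix_apply]
    apply h
    rintro ⟨h1, -⟩
    exact absurd h1 (Fin.succAbove_ne _ _)
  have hz : ∀ q : Fin s, N (Fin.last s) q.castSucc = M (Fin.last s) q.castSucc := by
    intro q
    apply h
    rintro ⟨-, h2⟩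
    exact absurd h2 (Fin.castSucc_lt_last q).ne
  simp only [hs, hz, ht]
  have : (Fin.last s).succAbove = Fin.castSucc := by ext; simp
  have e : (-1 : K) ^ ((Fin.last s : ℕ) + (Fin.last s : ℕ)) = 1 := by
    rw [← two_mul, pow_mul]; simp
  rw [e, this]
  ring

theorem exists_b {K : Type*} [Field K] (μ : ℕ → ℕ → K) (h : ∀ s i, μ s i ≠ 0)
    (h0 : ∀ i, μ 0 i = 1) (N : ℕ) : ∃ b : ℕ → ℕ → K, (∀ r c, c < r → b r c = 0) ∧
      ∀ s i, 2 * s + i < N → 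
        (Matrix.of fun p q : Fin (s+1) => b p (i + q)).det = μ (s+1) i := by
  induction N with
  | zero => exact ⟨fun _ _ => 0, by simp, by simp⟩
  | succ N ih =>
    obtain ⟨b, hb, hm⟩ := ih
    let t : ℕ → ℕ → K := fun r c => (μ (r+1) (c - r) - 
      (Matrix.of fun p q : Fin (r+1) => b p ((c-r) + q)).det) / μ r (c - r)
    refine ⟨fun r c => if r + c = N ∧ r ≤ c then b r c + t r c else b r c, ?_, ?_⟩
    · intro r c hrc
      simp only
      rw [if_neg (by omega), hb r c hrc]
    · intro s i hsi
      rcases Nat.lt_succ_iff_lt_or_eq.mp hsi with hlt | heq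
      · rw [← hm s i hlt]
        congr 1
        ext p q
        simp only [of_apply]
        rw [if_neg (by omega)]
      · rw [det_corner s (Matrix.of fun p q : Fin (s+1) => b p (i + q)) _ (t s (i+s))]
        · have hd : ((Matrix.of fun p q : Fin (s+1) => b p (i + q)).submatrix Fin.castSucc
              Fin.castSucc).det = μ s i := by
            rcases s with _ | s
            · simp [h0]
            · rw [← hm s i (by omega)]
              congr 1
          rw [hd]
          simp only [t, Nat.add_sub_cancel]
          rw [div_mul_cancel₀ _ (h s i)]
          ring
        · intro p q hpq
          simp only [of_apply]
          rw [if_neg]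
          rintro ⟨h1, h2⟩
          apply hpq
          constructor <;> ext <;> simp <;> omega
        · simp only [of_apply, Fin.val_last]
          rw [if_pos (by omega)]

theorem Jki_map {n : ℕ} {R S : Type*} [CommRing R] [CommRing S] (f : R →+* S) (k i : ℕ)
    (hk : k ≤ n) (hik : i < k) (A : Matrix (Fin n) (Fin n) R) :
    f (Jki k i hk hik A) = Jki k i hk hik (f.mapMatrix A) := by
  unfold Jki
  rw [RingHom.map_det, ← RingHom.map_adjugate]
  congr 1
  ext r c
  simp only [RingHom.mapMatrix_apply, map_apply, of_apply]
  split_ifs <;> rfl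

/-- sign of the order reversal -/
def revSign (K : Type*) [Ring K] (k : ℕ) : K :=
  ((Equiv.Perm.sign (Fin.revPerm : Equiv.Perm (Fin k)) : ℤ) : K)

theorem revSign_mul_self (K : Type*) [Ring K] (k : ℕ) : revSign K k * revSign K k = 1 := by
  unfold revSign
  rw [← Int.cast_mul, ← Units.val_mul, Int.units_mul_self]
  simp

theorem adj_formula {n : ℕ} {K : Type*} [Field K] (b : ℕ → ℕ → K)
    (hb : ∀ r c, c < r → b r c = 0) (hd : ∀ j, j < n → b j j ≠ 0)
    (A : Matrix (Fin n) (Fin n) K) (hA : A = of fun a c : Fin n => b (n - 1 - a) c) :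
    (∀ r c : Fin n, r < c → A.adjugate r.rev c = 0) ∧
    (∀ r : Fin n, A.adjugate r.rev r = A.det * (b (n - 1 - r) (n - 1 - r))⁻¹) ∧
    A.det = revSign K n * ∏ j ∈ Finset.range n, b j j := by
  set B : Matrix (Fin n) (Fin n) K := of fun a c : Fin n => b a c with hB
  have hAB : A = B.submatrix (Fin.revPerm : Equiv.Perm (Fin n)) (Equiv.refl (Fin n)) := by
    rw [hA, hB]
    ext a c
    simp only [of_apply, submatrix_apply, Fin.revPerm_apply, Fin.val_rev, Equiv.refl_apply]
    congr 1
    omega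
  have hBt : B.BlockTriangular id := by
    intro r c hrc
    exact hb _ _ hrc
  have hBd : B.det = ∏ j ∈ Finset.range n, b j j := by
    rw [Matrix.det_of_upperTriangular hBt, Finset.prod_range]
    rfl
  have hB0 : B.det ≠ 0 := by
    rw [hBd, Finset.prod_ne_zero_iff]
    intro j hj
    exact hd j (Finset.mem_range.mp hj)
  have hAd : A.det = revSign K n * B.det := by
    rw [hAB]
    exact Matrix.det_permute _ _
  have hA0 : A.det ≠ 0 := by
    intro h0
    rw [hAd] at h0
    rcases mul_eq_zero.mp h0 with h | h
    · have := revSign_mul_self K n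
      rw [h] at this
      simp at this
    · exact hB0 h
  have hBu : IsUnit B.det := isUnit_iff_ne_zero.mpr hB0
  haveI : Invertible B := Matrix.invertibleOfIsUnitDet B hBu
  have hBi : B⁻¹.BlockTriangular id := blockTriangular_inv_of_blockTriangular hBt
  have hadj : ∀ r c : Fin n, A.adjugate r c = A.det * B⁻¹ r c.rev := by
    intro r c
    have h1 : A⁻¹ = B⁻¹.submatrix (Equiv.refl (Fin n)) (Fin.revPerm : Equiv.Perm (Fin n)) := by
      rw [hAB, Matrix.inv_submatrix_equiv]
    have h2 : A.adjugate r c = A.det * A⁻¹ r c := by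
      rw [Matrix.inv_def, Matrix.smul_apply, Ring.inverse_eq_inv', smul_eq_mul,
        mul_inv_cancel_left₀ hA0]
    rw [h2, h1]
    rfl
  have hdiag : ∀ j : Fin n, B⁻¹ j j = (b j j)⁻¹ := by
    intro j
    have h1 : (B * B⁻¹) j j = 1 := by rw [Matrix.mul_nonsing_inv B hBu]; simp
    rw [Matrix.mul_apply, Finset.sum_eq_single j] at h1
    · exact eq_inv_of_mul_eq_one_right h1
    · intro l _ hl
      rcases lt_or_gt_of_ne hl with h | h
      · rw [show B j l = 0 from hBt h, zero_mul]
      · rw [show B⁻¹ l j = 0 from hBi h, mul_zero]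
    · simp
  refine ⟨?_, ?_, by rw [hAd, hBd]⟩
  · intro r c hrc
    rw [hadj, show B⁻¹ r.rev c.rev = 0 from hBi (by simpa using hrc), mul_zero]
  · intro r
    rw [hadj, hdiag]
    have : ((r.rev : Fin n) : ℕ) = n - 1 - r := by rw [Fin.val_rev]; omega
    rw [this]

theorem Jki_formula {n k i : ℕ} {K : Type*} [Field K] (hk : k ≤ n) (hik : i < k) (b : ℕ → ℕ → K)
    (hb : ∀ r c, c < r → b r c = 0) (hd : ∀ j, j < n → b j j ≠ 0)
    (A : Matrix (Fin n) (Fin n) K) (hA : A = of fun a c : Fin n => b (n - 1 - a) c) :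
    Jki k i hk hik A = revSign K k *
      ((∏ r ∈ Finset.range i, (A.det * (b (n - 1 - r) (n - 1 - r))⁻¹)) *
        (of fun p q : Fin (k - i) => b p (i + q)).det) := by
  obtain ⟨h1, h2, -⟩ := adj_formula b hb hd A hA
  obtain ⟨s, rfl⟩ := Nat.exists_eq_add_of_le hik.le
  have hs : i + s - i = s := by omega
  rw [hs]
  unfold Jki
  set N : Matrix (Fin (i + s)) (Fin (i + s)) K := of fun r c => _ with hN
  have hp : (N.submatrix (Fin.revPerm : Equiv.Perm (Fin (i + s))) id).det =
      revSign K (i + s) * N.det := Matrix.det_permute _ _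
  have hN1 : N.det = revSign K (i + s) *
      (N.submatrix (Fin.revPerm : Equiv.Perm (Fin (i + s))) id).det := by
    rw [hp, ← mul_assoc, revSign_mul_self, one_mul]
  rw [hN1, ← Matrix.det_submatrix_equiv_self (finSumFinEquiv : Fin i ⊕ Fin s ≃ Fin (i + s))]
  congr 1
  let L : Matrix (Fin i) (Fin i) K := of fun r c =>
    A.adjugate (Fin.rev (⟨r, by omega⟩ : Fin n)) ⟨c, by omega⟩
  let C : Matrix (Fin s) (Fin i) K := of fun r c => b r c
  let D : Matrix (Fin s) (Fin s) K := of fun p q => b p (i + q)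
  have hblk : (N.submatrix (Fin.revPerm : Equiv.Perm (Fin (i + s))) id).submatrix
      (finSumFinEquiv : Fin i ⊕ Fin s ≃ Fin (i + s)) finSumFinEquiv = fromBlocks L 0 C D := by
    ext r c
    rcases r with r | r
    · have key : ∀ c' : Fin (i + s), N (Fin.rev (Fin.castAdd s r)) c' =
          A.adjugate (Fin.rev (⟨r, by omega⟩ : Fin n)) ⟨c', by omega⟩ := by
        intro c'
        rw [hN]
        simp only [of_apply, Fin.val_rev, Fin.val_castAdd]
        rw [dif_neg (by omega)]
        congr 1
        ext
        simp only [Fin.val_rev]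
        omega
      rcases c with c | c
      · simp [key, L]
      · simp only [submatrix_apply, finSumFinEquiv_apply_left, finSumFinEquiv_apply_right, id,
          Fin.revPerm_apply, key, fromBlocks_apply₁₂, Matrix.zero_apply]
        apply h1
        rw [Fin.lt_def]
        simp
        omega
    · have key : ∀ c' : Fin (i + s), N (Fin.rev (Fin.natAdd i r)) c' = b r c' := by
        intro c'
        rw [hN]
        simp only [of_apply, Fin.val_rev, Fin.val_natAdd]
        rw [dif_pos (by omega), hA]
        simp only [of_apply]
        congr 1
        omega
      rcases c with c | c <;> simp [key, C, D]
  rw [hblk, Matrix.det_fromBlocks_zero₁₂]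
  congr 1
  rw [Matrix.det_of_lowerTriangular, Finset.prod_range]
  · apply Finset.prod_congr rfl
    intro r _
    exact h2 ⟨r, by omega⟩
  · intro r c hrc
    exact h1 _ _ hrc

theorem exists_point {n : ℕ} {K : Type*} [Field K]
    (y : {p : ℕ × ℕ // p.1 ≤ n ∧ p.2 < p.1} → K) (hy : ∀ p, y p ≠ 0) :
    ∃ A : Matrix (Fin n) (Fin n) K, ∀ p : {p : ℕ × ℕ // p.1 ≤ n ∧ p.2 < p.1},
      Jki p.1.1 p.1.2 p.2.1 p.2.2 A = y p := by
  classical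
  let Y : ℕ → ℕ → K := fun k i => if h : k ≤ n ∧ i < k then y ⟨(k, i), h⟩ else 1
  have hY : ∀ k i, Y k i ≠ 0 := by
    intro k i
    simp only [Y]
    split_ifs
    · exact hy _
    · exact one_ne_zero
  have hε : ∀ k, revSign K k ≠ 0 := fun k h => by
    have := revSign_mul_self K k
    simp [h] at this
  let D : ℕ → K := fun k => revSign K k * Y k 0
  have hD : ∀ k, D k ≠ 0 := fun k => mul_ne_zero (hε k) (hY k 0)
  have hD0 : D 0 = 1 := by simp [D, Y, revSign, Subsingleton.elim (Fin.revPerm : Equiv.Perm (Fin 0)) 1]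
  let d : ℕ → K := fun j => D (j + 1) / D j
  have hdn : ∀ j, d j ≠ 0 := fun j => div_ne_zero (hD _) (hD _)
  let f : ℕ → K := fun i => ∏ r ∈ Finset.range i, (Y n 0 * (d (n - 1 - r))⁻¹)
  have hf : ∀ i, f i ≠ 0 := fun i => Finset.prod_ne_zero_iff.mpr fun r _ =>
    mul_ne_zero (hY _ _) (inv_ne_zero (hdn _))
  let μ : ℕ → ℕ → K := fun s i => if s = 0 then 1 else revSign K (s + i) * Y (s + i) i / f i
  have hμ : ∀ s i, μ s i ≠ 0 := by
    intro s i
    simp only [μ]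
    split_ifs
    · exact one_ne_zero
    · exact div_ne_zero (mul_ne_zero (hε _) (hY _ _)) (hf _)
  obtain ⟨b, hb, hm⟩ := exists_b μ hμ (by simp [μ]) (3 * n)
  have hprod : ∀ s, s ≤ n → ∏ j ∈ Finset.range s, b j j = D s := by
    intro s hs
    rcases s with _ | s
    · simp [hD0]
    · have h := hm s 0 (by omega)
      rw [Matrix.det_of_upperTriangular] at h
      · rw [Finset.prod_range]
        simpa [μ, f, D] using h
      · intro r c hrc
        exact hb _ _ (by simpa using hrc)
  have hbd : ∀ j, j < n → b j j = d j := by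
    intro j hj
    have h1 := hprod (j + 1) hj
    rw [Finset.prod_range_succ, hprod j hj.le] at h1
    simp only [d]
    rw [eq_div_iff (hD j), ← h1, mul_comm]
  have hbn : ∀ j, j < n → b j j ≠ 0 := fun j hj => by rw [hbd j hj]; exact hdn j
  refine ⟨of fun a c : Fin n => b (n - 1 - a) c, ?_⟩
  rintro ⟨⟨k, i⟩, hk, hik⟩
  simp only at hk hik ⊢
  rw [Jki_formula hk hik b hb hbn _ rfl, (adj_formula b hb hbn _ rfl).2.2, hprod n le_rfl]
  have e1 : revSign K n * D n = Y n 0 := by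
    simp only [D]
    rw [← mul_assoc, revSign_mul_self, one_mul]
  have e2 : ∏ r ∈ Finset.range i, (revSign K n * D n * (b (n - 1 - r) (n - 1 - r))⁻¹) = f i := by
    apply Finset.prod_congr rfl
    intro r hr
    rw [Finset.mem_range] at hr
    rw [e1, hbd _ (by omega)]
  obtain ⟨s, rfl⟩ : ∃ s, k = s + 1 + i := ⟨k - i - 1, by omega⟩
  have e3 : s + 1 + i - i = s + 1 := by omega
  rw [e2, e3, hm s i (by omega)]
  simp only [μ, Nat.succ_ne_zero, if_false]
  rw [mul_div_cancel₀ _ (hf i), ← mul_assoc, revSign_mul_self, one_mul]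
  simp only [Y]
  rw [dif_pos ⟨hk, hik⟩]

/-- The family `{J_{k,i} : 1 ≤ k ≤ n, 0 ≤ i ≤ k-1}` of `n(n+1)/2` polynomials
in `K[x]` is algebraically independent over `K`. -/
theorem Jki_algebraicIndependent {n : ℕ} {K : Type*} [Field K] [CharZero K]
    (hn : 1 ≤ n) :
    AlgebraicIndependent K
      (fun p : {p : ℕ × ℕ // p.1 ≤ n ∧ p.2 < p.1} =>
        Jki p.1.1 p.1.2 p.2.1 p.2.2 (genMatrix K n)) := by
  rw [algebraicIndependent_iff]
  intro P hP
  have hinf : (({0} : Set K)ᶜ).Infinite := (Set.finite_singleton 0).infinite_compl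
  refine MvPolynomial.funext_set (fun _ => ({0} : Set K)ᶜ) (fun _ => hinf) ?_
  intro y hy
  obtain ⟨A, hA⟩ := exists_point y (fun p => hy p trivial)
  have h1 := congrArg (MvPolynomial.aeval (R := K) (fun ab : Fin n × Fin n => A ab.1 ab.2)) hP
  rw [← AlgHom.comp_apply, MvPolynomial.comp_aeval, map_zero] at h1
  rw [map_zero, ← h1, ← MvPolynomial.coe_aeval_eq_eval]
  simp only [RingHom.coe_coe]
  congr 2
  funext p
  rw [← hA p]
  symm
  refine (Jki_map (MvPolynomial.aeval (R := K)
    (fun ab : Fin n × Fin n => A ab.1 ab.2)).toRingHom _ _ _ _ _).trans ?_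
  congr 1
  ext a c
  simp [genMatrix]
end

section
/- A U-invariant polynomial is determined by its restriction to L: if f ∈ K[x] satisfies ρ_u f = f for all u ∈ U, and the evaluation of f at every matrix B ∈ L is zero, then f = 0. -/
open Matrix MvPolynomial

/-- `u` is an upper triangular matrix with all diagonal entries equal to `1`
(upper unitriangular matrix). -/
def IsUniUpperTriangular {n : ℕ} {K : Type*} [CommRing K]
    (u : Matrix (Fin n) (Fin n) K) : Prop :=
  (∀ a : Fin n, u a a = 1) ∧ ∀ a b : Fin n, (b : ℕ) < (a : ℕ) → u a b = 0

/-- The `K`-algebra endomorphism `ρ_u` of `K[x]` sending each `x_{ab}` to the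
`(a,b)` entry of `u⁻¹ X u`, where `X` is the generic matrix. -/
noncomputable def rho {n : ℕ} {K : Type*} [Field K]
    (u : Matrix (Fin n) (Fin n) K) :
    MvPolynomial (Fin n × Fin n) K →ₐ[K] MvPolynomial (Fin n × Fin n) K :=
  MvPolynomial.aeval fun ab =>
    (((u⁻¹).map MvPolynomial.C * genMatrix K n * u.map MvPolynomial.C :
      Matrix (Fin n) (Fin n) (MvPolynomial (Fin n × Fin n) K)) ab.1 ab.2)

/-- `B` belongs to `L`: all entries strictly above the anti-diagonal vanish
and all anti-diagonal entries are nonzero. -/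
def MemL {n : ℕ} {K : Type*} [CommRing K] (B : Matrix (Fin n) (Fin n) K) : Prop :=
  (∀ a c : Fin n, (a : ℕ) + (c : ℕ) + 2 ≤ n → B a c = 0) ∧
    ∀ c : Fin n, B ⟨n - 1 - (c : ℕ), by have := c.isLt; omega⟩ c ≠ 0

theorem uni_det {n : ℕ} {K : Type*} [Field K] {v : Matrix (Fin n) (Fin n) K}
    (hv : IsUniUpperTriangular v) : v.det = 1 := by
  have ht : v.BlockTriangular id := fun i j h => hv.2 i j h
  rw [Matrix.det_of_upperTriangular ht]
  exact Finset.prod_eq_one fun i _ => hv.1 i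

theorem uni_inv {n : ℕ} {K : Type*} [Field K] {v : Matrix (Fin n) (Fin n) K}
    (hv : IsUniUpperTriangular v) : IsUniUpperTriangular v⁻¹ := by
  have ht : v.BlockTriangular id := fun i j h => hv.2 i j h
  have hu : IsUnit v.det := by rw [uni_det hv]; exact isUnit_one
  haveI : Invertible v := Matrix.invertibleOfIsUnitDet v hu
  have hi : v⁻¹.BlockTriangular id := Matrix.blockTriangular_inv_of_blockTriangular ht
  refine ⟨fun a => ?_, fun a b h => hi h⟩
  have h1 : (v * v⁻¹) a a = 1 := by rw [Matrix.mul_nonsing_inv v hu]; simp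
  rw [Matrix.mul_apply, Finset.sum_eq_single a] at h1
  · simpa [hv.1 a] using h1
  · intro b _ hb
    rcases lt_or_gt_of_ne hb with h | h
    · rw [hv.2 a b h, zero_mul]
    · rw [hi (i := b) (j := a) h, mul_zero]
  · simp

/-- Leading block of the row-reversed matrix. -/
def lead {n : ℕ} {R : Type*} (A : Matrix (Fin n) (Fin n) R) (a : Fin n) :
    Matrix {j : Fin n // j < a.rev} {j : Fin n // j < a.rev} R :=
  A.submatrix (fun j => j.1.rev) (fun j => j.1)

theorem exists_row {n : ℕ} {K : Type*} [Field K] (A : Matrix (Fin n) (Fin n) K)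
    (a : Fin n) (h : (lead A a).det ≠ 0) :
    ∃ r : Fin n → K, r a = 1 ∧ (∀ b, b < a → r b = 0) ∧
      ∀ c, c < a.rev → ∑ b, r b * A b c = 0 := by
  have hu : IsUnit (lead A a).det := isUnit_iff_ne_zero.2 h
  set y : {j : Fin n // j < a.rev} → K := fun c => - A a c.1 with hy
  set x := Matrix.vecMul y (lead A a)⁻¹ with hx
  have hxl : Matrix.vecMul x (lead A a) = y := by
    rw [hx, Matrix.vecMul_vecMul, Matrix.nonsing_inv_mul _ hu, Matrix.vecMul_one]
  refine ⟨fun b => if b = a then 1 else if hb : b.rev < a.rev then x ⟨b.rev, hb⟩ else 0,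
    by simp, ?_, ?_⟩
  · intro b hb
    have h1 : b ≠ a := hb.ne
    have h2 : ¬ b.rev < a.rev := by rw [Fin.rev_lt_rev]; exact not_lt.2 hb.le
    simp only [h1, h2, if_false, dif_neg, not_false_eq_true]
  · intro c hc
    have h1 := congrFun hxl ⟨c, hc⟩
    simp only [Matrix.vecMul, dotProduct, lead, Matrix.submatrix_apply, hy] at h1
    rw [← Finset.add_sum_erase _ _ (Finset.mem_univ a)]
    simp only [if_true, one_mul]
    have h2 : ∑ b ∈ Finset.univ.erase a, (if b = a then (1 : K) else
        if hb : b.rev < a.rev then x ⟨b.rev, hb⟩ else 0) * A b c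
        = ∑ j : {j : Fin n // j < a.rev}, x j * A j.1.rev c := by
      symm
      apply Finset.sum_of_injOn (fun j => j.1.rev)
      · intro i _ j _ hij
        exact Subtype.ext (Fin.rev_injective hij)
      · intro j _
        have := j.2
        simp only [Finset.coe_erase, Finset.coe_univ, Set.mem_diff, Set.mem_univ, true_and,
          Set.mem_singleton_iff]
        intro h3
        rw [Fin.rev_eq_iff] at h3
        exact this.ne h3
      · intro b hb hb2
        have h3 : b ≠ a := (Finset.mem_erase.1 hb).1
        have h4 : ¬ b.rev < a.rev := by
          intro h5
          exact hb2 ⟨⟨b.rev, h5⟩, by simp, by simp⟩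
        rw [if_neg h3, dif_neg h4, zero_mul]
      · intro j _
        have h3 : j.1.rev ≠ a := by
          intro h3
          rw [Fin.rev_eq_iff] at h3
          exact j.2.ne h3
        have h4 : j.1.rev.rev < a.rev := by rw [Fin.rev_rev]; exact j.2
        rw [if_neg h3, dif_pos h4]
        congr 2
        exact Subtype.ext (Fin.rev_rev _).symm
    rw [h2, h1]
    ring

theorem exists_conj {n : ℕ} {K : Type*} [Field K] (A : Matrix (Fin n) (Fin n) K)
    (h : ∀ a, (lead A a).det ≠ 0) (hd : (A.submatrix Fin.rev id).det ≠ 0) :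
    ∃ v : Matrix (Fin n) (Fin n) K, IsUniUpperTriangular v ∧ MemL (v * A * v⁻¹) := by
  choose v h1 h2 h3 using fun a => exists_row A a (h a)
  have hv : IsUniUpperTriangular (Matrix.of v) := ⟨h1, fun a b hab => h2 a b hab⟩
  have hi := uni_inv hv
  have hz : ∀ a c : Fin n, c < a.rev → (Matrix.of v * A) a c = 0 := fun a c hc => by
    rw [Matrix.mul_apply]; exact h3 a c hc
  refine ⟨Matrix.of v, hv, ?_, ?_⟩
  · intro a c hac
    rw [Matrix.mul_apply]
    refine Finset.sum_eq_zero fun d _ => ?_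
    by_cases hdc : c < d
    · rw [hi.2 d c hdc, mul_zero]
    · rw [hz, zero_mul]
      rw [Fin.lt_def, Fin.val_rev]
      rw [Fin.lt_def] at hdc
      omega
  · intro c
    have hrev : (⟨n - 1 - (c : ℕ), by have := c.isLt; omega⟩ : Fin n) = c.rev := by
      ext; simp only [Fin.val_rev]; omega
    rw [hrev, Matrix.mul_apply, Finset.sum_eq_single c]
    · rw [hi.1 c, mul_one]
      have hM : ((Matrix.of v * A).submatrix Fin.rev id).BlockTriangular id := by
        intro i j hij
        apply hz
        rw [Fin.rev_rev]; exact hij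
      have hdet := Matrix.det_of_upperTriangular hM
      have he : (Matrix.of v * A).submatrix Fin.rev id =
          (Matrix.of v).submatrix Fin.revPerm Fin.revPerm * A.submatrix Fin.rev id := by
        rw [show A.submatrix Fin.rev id = A.submatrix Fin.revPerm id from rfl,
          Matrix.submatrix_mul_equiv]
        rfl
      rw [he, Matrix.det_mul, Matrix.det_submatrix_equiv_self, uni_det hv, one_mul, ← he] at hdet
      rw [hdet] at hd
      exact (Finset.prod_ne_zero_iff.1 hd) c (Finset.mem_univ c)
    · intro d _ hdc
      rcases lt_or_gt_of_ne hdc with h | h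
      · rw [hz, zero_mul]; rw [Fin.rev_rev]; exact h
      · rw [hi.2 d c h, mul_zero]
    · simp

theorem eval_rho {n : ℕ} {K : Type*} [Field K] (A u : Matrix (Fin n) (Fin n) K)
    (f : MvPolynomial (Fin n × Fin n) K) :
    MvPolynomial.eval (fun ab : Fin n × Fin n => A ab.1 ab.2) (rho u f) =
      MvPolynomial.eval (fun ab : Fin n × Fin n => (u⁻¹ * A * u) ab.1 ab.2) f := by
  unfold rho
  rw [MvPolynomial.aeval_def, MvPolynomial.eval₂_eq', map_sum, MvPolynomial.eval_eq']
  refine Finset.sum_congr rfl fun d _ => ?_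
  rw [map_mul, map_prod]
  congr 1
  · simp
  · refine Finset.prod_congr rfl fun i _ => ?_
    rw [map_pow]
    simp [Matrix.mul_apply, genMatrix]

/-- A `U`-invariant polynomial is determined by its restriction to `L`: if
`ρ_u f = f` for all upper unitriangular `u`, and `f` vanishes at every matrix
`B ∈ L`, then `f = 0`. -/
theorem U_invariant_vanishing_on_L_eq_zero {n : ℕ} {K : Type*} [Field K]
    [CharZero K] (hn : 1 ≤ n) (f : MvPolynomial (Fin n × Fin n) K)
    (hinv : ∀ u : Matrix (Fin n) (Fin n) K, IsUniUpperTriangular u →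
      rho u f = f)
    (hvan : ∀ B : Matrix (Fin n) (Fin n) K, MemL B →
      MvPolynomial.eval (fun ab : Fin n × Fin n => B ab.1 ab.2) f = 0) :
    f = 0 := by
  set ev : Matrix (Fin n) (Fin n) K → MvPolynomial (Fin n × Fin n) K →+* K :=
    fun A => MvPolynomial.eval (fun ab : Fin n × Fin n => A ab.1 ab.2) with hev
  have hgen : ∀ A, (ev A).mapMatrix (genMatrix K n) = A := by
    intro A; ext a b; simp [hev, genMatrix]
  have hl : ∀ A a, ev A (lead (genMatrix K n) a).det = (lead A a).det := by
    intro A a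
    rw [RingHom.map_det]
    conv_rhs => rw [← hgen A]
    rfl
  have hD : ∀ A, ev A ((genMatrix K n).submatrix Fin.rev id).det
      = (A.submatrix Fin.rev id).det := by
    intro A
    rw [RingHom.map_det]
    conv_rhs => rw [← hgen A]
    rfl
  set W : Matrix (Fin n) (Fin n) K := (1 : Matrix (Fin n) (Fin n) K).submatrix Fin.rev id with hW
  have hW1 : W.submatrix Fin.rev id = 1 := by
    ext a b
    simp only [hW, Matrix.submatrix_apply, Matrix.one_apply, Fin.rev_rev, id]
  have hW2 : ∀ a, lead W a = 1 := by
    intro a; ext i j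
    simp [lead, hW, Matrix.one_apply, Subtype.ext_iff]
  set P : MvPolynomial (Fin n × Fin n) K := ((genMatrix K n).submatrix Fin.rev id).det *
    ∏ a, (lead (genMatrix K n) a).det with hP
  have hP0 : P ≠ 0 := by
    intro h0
    have h1 : ev W P = 0 := by rw [h0, map_zero]
    rw [hP, map_mul, map_prod, hD, hW1] at h1
    simp [hl, hW2] at h1
  have hfP : f * P = 0 := by
    apply MvPolynomial.funext
    intro x
    set A : Matrix (Fin n) (Fin n) K := Matrix.of fun a b => x (a, b) with hA
    have hx : MvPolynomial.eval x = ev A := rfl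
    rw [hx, map_zero, map_mul]
    by_cases hPA : ev A P = 0
    · rw [hPA, mul_zero]
    · rw [hP, map_mul, map_prod, hD] at hPA
      have h1 := left_ne_zero_of_mul hPA
      have h2 := Finset.prod_ne_zero_iff.1 (right_ne_zero_of_mul hPA)
      obtain ⟨v, hv, hvL⟩ := exists_conj A
        (fun a => by rw [← hl]; exact h2 a (Finset.mem_univ a)) h1
      have hu : IsUnit v.det := by rw [uni_det hv]; exact isUnit_one
      have h3 := eval_rho A v⁻¹ f
      rw [hinv _ (uni_inv hv), Matrix.nonsing_inv_nonsing_inv v hu, hvan _ hvL] at h3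
      have h4 : ev A f = 0 := h3
      rw [h4, zero_mul]
  exact (mul_eq_zero.1 hfP).resolve_right hP0
end
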